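/- Let X be a locally compact metrizable space and let h : X → X be a homeomorphism. Let d, k, m ∈ ℕ with k ≥ 1, let ε > 0, set k' = k·⌈1/ε⌉, and assume m ≥ k'. Let K ⊆ X be compact and suppose Z^{(0)},…,Z^{(2d+2)} ⊆ X are open sets such that for every l ∈ {0,…,2d+2} the sets h^{-m}(closure(Z^{(l)})), …, h^{m}(closure(Z^{(l)})) are pairwise disjoint, and ⋃_{i=-k'}^{k'} h^{i}(K) ⊆ ⋃_{l=0}^{2d+2} ⋃_{i=-(m-k')}^{m-k'} h^{i}(Z^{(l)}). Then there exist continuous compactly supported functions μ_j^{(l)} : X → [0,1], for l ∈ {0,…,2d+2} and j ∈ ℤ, such that: (c) the support of μ_j^{(l)} is contained in h^{j}(Z^{(l)}) whenever |j| ≤ m, and μ_j^{(l)} = 0 whenever |j| > m; (d) Σ_{l=0}^{2d+2} Σ_{j=-m}^{m} μ_j^{(l)}(x) = 1 for every x ∈ K; and (e) sup_{x∈X} |μ_j^{(l)}(h^{i}(x)) − μ_{j-i}^{(l)}(x)| < ε for every j ∈ ℤ, every i ∈ ℤ with |i| ≤ k, and every l ∈ {0,…,2d+2}. -/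

import Mathlib

/-- Integer powers of the underlying permutation of a homeomorphism are homeomorphisms. -/
theorem Homeomorph.exists_toEquiv_eq_zpow {X : Type*} [TopologicalSpace X] (h : X ≃ₜ X) (i : ℤ) :
    ∃ g : X ≃ₜ X, g.toEquiv = h.toEquiv ^ i := by
  induction i using Int.induction_on with
  | zero => exact ⟨Homeomorph.refl X, rfl⟩
  | succ n ih =>
    obtain ⟨g, hg⟩ := ih
    refine ⟨h.trans g, ?_⟩
    rw [zpow_add_one, ← hg]
    rfl
  | pred n ih =>
    obtain ⟨g, hg⟩ := ih
    refine ⟨h.symm.trans g, ?_⟩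
    rw [zpow_sub_one, ← hg]
    rfl

/-- A compact set covered by finitely many open sets has a subordinate partition of unity by
compactly supported functions. -/
theorem IsCompact.exists_continuous_sum_eq_one {X ι : Type*} [TopologicalSpace X] [T2Space X]
    [LocallyCompactSpace X] [Fintype ι] {K : Set X} (hK : IsCompact K) {U : ι → Set X}
    (hU : ∀ i, IsOpen (U i)) (hKU : K ⊆ ⋃ i, U i) :
    ∃ f : ι → X → ℝ, (∀ i, Continuous (f i)) ∧ (∀ i, HasCompactSupport (f i)) ∧
      (∀ i x, f i x ∈ Set.Icc (0 : ℝ) 1) ∧ (∀ i, tsupport (f i) ⊆ U i) ∧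
      ∀ x ∈ K, ∑ i, f i x = 1 := by
  let e := Fintype.equivFin ι
  obtain ⟨f, hfU, hf1, hf01, hfc⟩ := exists_continuous_sum_one_of_isOpen_isCompact
    (s := fun n => U (e.symm n)) (fun n => hU _) hK (by rwa [e.symm.surjective.iUnion_comp])
  refine ⟨fun i => f (e i), fun i => (f (e i)).continuous, fun i => hfc _, fun i => hf01 _,
    fun i => by simpa using hfU (e i), fun x hx => ?_⟩
  rw [e.sum_comp (fun n => f n x)]
  simpa using hf1 hx

/-- Translating the summation interval of a `[0, 1]`-valued sequence by `i` changes the sum by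
at most `|i|`. -/
theorem abs_sum_Icc_sub_sum_Icc_add_le {f : ℤ → ℝ} (hf : ∀ s, f s ∈ Set.Icc (0 : ℝ) 1)
    (a b i : ℤ) :
    |∑ s ∈ Finset.Icc a b, f s - ∑ s ∈ Finset.Icc a b, f (s + i)| ≤ |(i : ℝ)| := by
  have key : ∀ S T : Finset ℤ, (S \ T).card ≤ i.natAbs →
      ∑ s ∈ S, f s - ∑ s ∈ T, f s ≤ |(i : ℝ)| := fun S T hST => by
    rw [← Finset.sum_sdiff_sub_sum_sdiff]
    have h₁ : ∑ s ∈ S \ T, f s ≤ (S \ T).card := by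
      simpa using Finset.sum_le_card_nsmul (S \ T) f 1 fun s _ => (hf s).2
    have h₂ : 0 ≤ ∑ s ∈ T \ S, f s := Finset.sum_nonneg fun s _ => (hf s).1
    have h₃ : ((S \ T).card : ℝ) ≤ |(i : ℝ)| := by
      rw [← Int.cast_abs, Int.abs_eq_natAbs]
      exact_mod_cast hST
    linarith
  have translate : ∑ s ∈ Finset.Icc a b, f (s + i) = ∑ s ∈ Finset.Icc (a + i) (b + i), f s := by
    rw [← Finset.map_add_right_Icc, Finset.sum_map]
    rfl
  have card_le : ∀ a b i : ℤ,
      (Finset.Icc a b \ Finset.Icc (a + i) (b + i)).card ≤ i.natAbs := fun a b i => by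
    have hsub : Finset.Icc a b \ Finset.Icc (a + i) (b + i) ⊆
        Finset.Ico a (a + i) ∪ Finset.Ioc (b + i) b := fun s hs => by
      simp only [Finset.mem_sdiff, Finset.mem_Icc, Finset.mem_union, Finset.mem_Ico,
        Finset.mem_Ioc] at hs ⊢
      omega
    refine (Finset.card_le_card hsub).trans ((Finset.card_union_le _ _).trans ?_)
    simp only [Int.card_Ico, Int.card_Ioc]
    omega
  rw [translate, abs_le']
  refine ⟨key _ _ (card_le a b i), ?_⟩
  rw [neg_sub]
  exact key _ _ (by simpa using card_le (a + i) (b + i) (-i))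

/-- The functions of a partition of unity extended by zero outside a finite tower of open sets. -/
theorem exists_tower_partition_of_unity {X L : Type*} [TopologicalSpace X] [T2Space X]
    [LocallyCompactSpace X] [Fintype L] {K : Set X} (hK : IsCompact K) (S : Finset ℤ)
    {U : L → ℤ → Set X} (hU : ∀ l i, IsOpen (U l i)) (hKU : K ⊆ ⋃ l, ⋃ i ∈ S, U l i) :
    ∃ ν : L → ℤ → X → ℝ, (∀ l i, Continuous (ν l i)) ∧ (∀ l i, HasCompactSupport (ν l i)) ∧
      (∀ l i x, ν l i x ∈ Set.Icc (0 : ℝ) 1) ∧ (∀ l i, tsupport (ν l i) ⊆ U l i) ∧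
      (∀ l, ∀ i ∉ S, ν l i = 0) ∧ ∀ x ∈ K, ∑ l, ∑ i ∈ S, ν l i x = 1 := by
  obtain ⟨f, hfc, hfs, hf01, hfU, hf1⟩ := hK.exists_continuous_sum_eq_one
    (U := fun p : L × S => U p.1 p.2) (fun p => hU _ _) (fun x hx => by
      obtain ⟨l, i, hi, hx⟩ := by simpa using hKU hx
      exact Set.mem_iUnion.2 ⟨(l, ⟨i, hi⟩), hx⟩)
  refine ⟨fun l i => if hi : i ∈ S then f (l, ⟨i, hi⟩) else 0, fun l i => ?_, fun l i => ?_,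
    fun l i x => ?_, fun l i => ?_, fun l i hi => dif_neg hi, fun x hx => ?_⟩
  · dsimp only
    split_ifs
    exacts [hfc _, continuous_zero]
  · dsimp only
    split_ifs
    exacts [hfs _, HasCompactSupport.zero]
  · dsimp only
    split_ifs
    exacts [hf01 _ x, by simp]
  · dsimp only
    split_ifs
    exacts [hfU _, by simp [tsupport]]
  · rw [← hf1 x hx, Fintype.sum_prod_type]
    refine Finset.sum_congr rfl fun l _ => ?_
    rw [← Finset.sum_coe_sort S]
    exact Finset.sum_congr rfl fun i _ => by simp only [dif_pos i.2, Subtype.coe_eta]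

/-- Averages along an orbit segment of functions subordinate to translates of a set `Z`
are again compactly supported in a translate of `Z`. -/
theorem isCompact_tsupport_orbit_average {X : Type*} [TopologicalSpace X] [T2Space X]
    (h : X ≃ₜ X) {Z : Set X} {ν : ℤ → X → ℝ} (hc : ∀ i, HasCompactSupport (ν i))
    (hZ : ∀ i, tsupport (ν i) ⊆ (h.toEquiv ^ i) '' Z) (S : Finset ℤ) (c : ℝ) (j : ℤ) :
    HasCompactSupport (fun x => (∑ s ∈ S, ν (j - s) ((h.toEquiv ^ (-s)) x)) / c) ∧
      tsupport (fun x => (∑ s ∈ S, ν (j - s) ((h.toEquiv ^ (-s)) x)) / c) ⊆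
        (h.toEquiv ^ j) '' Z := by
  have compact : IsCompact (⋃ s ∈ S, (h.toEquiv ^ s) '' tsupport (ν (j - s))) :=
    S.isCompact_biUnion fun s _ => by
      obtain ⟨g, hg⟩ := h.exists_toEquiv_eq_zpow s
      rw [← hg]
      exact (hc _).image g.continuous
  have subset : tsupport (fun x => (∑ s ∈ S, ν (j - s) ((h.toEquiv ^ (-s)) x)) / c) ⊆
      ⋃ s ∈ S, (h.toEquiv ^ s) '' tsupport (ν (j - s)) := by
    refine closure_minimal (fun x hx => ?_) compact.isClosed
    obtain ⟨s, hs, hne⟩ := Finset.exists_ne_zero_of_sum_ne_zero (div_ne_zero_iff.1 hx).1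
    exact Set.mem_biUnion hs ⟨_, subset_closure hne, by
      rw [← Equiv.Perm.mul_apply, ← zpow_add, add_neg_cancel, zpow_zero, Equiv.Perm.one_apply]⟩
  refine ⟨compact.of_isClosed_subset (isClosed_tsupport _) subset, subset.trans ?_⟩
  refine Set.iUnion₂_subset fun s _ => (Set.image_mono (hZ _)).trans ?_
  rw [← Set.image_comp, ← Equiv.Perm.coe_mul, ← zpow_add, add_sub_cancel]


/-- Rokhlin tower functions for homeomorphisms without short orbits: given towers of open
sets `Z^(0), …, Z^(2d+2)` whose iterates `h^{-m}(closure Z^(l)), …, h^{m}(closure Z^(l))`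
are pairwise disjoint and which cover the `k'`-thickening of a compact set `K` (where
`k' = k⌈1/ε⌉ ≤ m`) by the iterates `h^i(Z^(l))`, `|i| ≤ m - k'`, there exist continuous
compactly supported functions `μ_j^(l) : X → [0,1]` such that: `μ_j^(l)` is supported in
`h^j(Z^(l))` for `|j| ≤ m` and vanishes for `|j| > m`; the `μ_j^(l)` sum to `1` on `K`; and
`|μ_j^(l)(h^i(x)) − μ_{j-i}^(l)(x)| < ε` for all `x`, all `|i| ≤ k` and all `j`. -/
theorem rokhlin_tower_functions
    {X : Type*} [TopologicalSpace X] [LocallyCompactSpace X] [TopologicalSpace.MetrizableSpace X]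
    (h : X ≃ₜ X) (d k m : ℕ) (hk : 1 ≤ k) (ε : ℝ) (hε : 0 < ε)
    (k' : ℕ) (hk' : k' = k * ⌈1 / ε⌉₊) (hm : k' ≤ m)
    (K : Set X) (hK : IsCompact K)
    (Zl : Fin (2 * d + 3) → Set X) (hZopen : ∀ l, IsOpen (Zl l))
    (hdisj : ∀ l, ∀ i ∈ Set.Icc (-(m : ℤ)) (m : ℤ), ∀ j ∈ Set.Icc (-(m : ℤ)) (m : ℤ),
      i ≠ j →
      Disjoint ((h.toEquiv ^ i) '' closure (Zl l)) ((h.toEquiv ^ j) '' closure (Zl l)))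
    (hcover : (⋃ i ∈ Set.Icc (-(k' : ℤ)) (k' : ℤ), (h.toEquiv ^ i) '' K) ⊆
      ⋃ l : Fin (2 * d + 3),
        ⋃ i ∈ Set.Icc (-((m : ℤ) - (k' : ℤ))) ((m : ℤ) - (k' : ℤ)),
          (h.toEquiv ^ i) '' Zl l) :
    ∃ μ : Fin (2 * d + 3) → ℤ → X → ℝ,
      (∀ l j, Continuous (μ l j)) ∧
      (∀ l j, HasCompactSupport (μ l j)) ∧
      (∀ l j x, 0 ≤ μ l j x ∧ μ l j x ≤ 1) ∧
      (∀ l, ∀ j : ℤ, |j| ≤ (m : ℤ) → tsupport (μ l j) ⊆ (h.toEquiv ^ j) '' Zl l) ∧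
      (∀ l, ∀ j : ℤ, (m : ℤ) < |j| → μ l j = 0) ∧
      (∀ x ∈ K, ∑ l : Fin (2 * d + 3), ∑ j ∈ Finset.Icc (-(m : ℤ)) (m : ℤ), μ l j x = 1) ∧
      (∀ l, ∀ j i : ℤ, |i| ≤ (k : ℤ) → ∀ x : X,
        |μ l j ((h.toEquiv ^ i) x) - μ l (j - i) x| < ε) := by
  subst hk'
  set k' := k * ⌈1 / ε⌉₊ with hk'
  have hcont : ∀ i : ℤ, Continuous (h.toEquiv ^ i : X ≃ X) := fun i => by
    obtain ⟨g, hg⟩ := h.exists_toEquiv_eq_zpow i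
    rw [← hg]
    exact g.continuous
  have hopen : ∀ l (i : ℤ), IsOpen ((h.toEquiv ^ i) '' Zl l) := fun l i => by
    obtain ⟨g, hg⟩ := h.exists_toEquiv_eq_zpow i
    rw [← hg]
    exact g.isOpenMap _ (hZopen l)
  have hKc : IsCompact (⋃ i ∈ Set.Icc (-(k' : ℤ)) (k' : ℤ), (h.toEquiv ^ i) '' K) :=
    (Set.finite_Icc _ _).isCompact_biUnion fun i _ => hK.image (hcont i)
  obtain ⟨ν, hνc, hνs, hν01, hνU, hν0, hν1⟩ := exists_tower_partition_of_unity hKc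
    (Finset.Icc (-((m : ℤ) - (k' : ℤ))) ((m : ℤ) - (k' : ℤ)))
    (U := fun l i => (h.toEquiv ^ i) '' Zl l) hopen
    (by simpa only [Finset.mem_Icc, Set.mem_Icc] using hcover)
  have hN : (0 : ℝ) < 2 * k' + 1 := by positivity
  have hcard : ((Finset.Icc (-(k' : ℤ)) k').card : ℝ) = 2 * k' + 1 := by
    have : (Finset.Icc (-(k' : ℤ)) k').card = 2 * k' + 1 := by
      rw [Int.card_Icc]
      omega
    rw [this]
    push_cast
    ring
  have hsupp := fun l => isCompact_tsupport_orbit_average h (hνs l) (hνU l)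
    (Finset.Icc (-(k' : ℤ)) k') (2 * k' + 1)
  refine ⟨fun l j x => (∑ s ∈ Finset.Icc (-(k' : ℤ)) k', ν l (j - s) ((h.toEquiv ^ (-s)) x)) /
    (2 * k' + 1), fun l j => ?_, fun l j => (hsupp l j).1, fun l j x => ⟨?_, ?_⟩,
    fun l j _ => (hsupp l j).2, fun l j hj => ?_, fun x hx => ?_, fun l j i hi x => ?_⟩
  · exact (continuous_finsetSum _ fun s _ => (hνc l _).comp (hcont _)).div_const _
  · exact div_nonneg (Finset.sum_nonneg fun s _ => (hν01 _ _ _).1) hN.le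
  · rw [div_le_one hN, ← hcard]
    simpa using Finset.sum_le_card_nsmul (Finset.Icc (-(k' : ℤ)) k')
      (fun s => ν l (j - s) ((h.toEquiv ^ (-s)) x)) 1 fun s _ => (hν01 _ _ _).2
  · funext x
    have : ∀ s ∈ Finset.Icc (-(k' : ℤ)) k', ν l (j - s) ((h.toEquiv ^ (-s)) x) = 0 :=
      fun s hs => by
        rw [hν0 l (j - s), Pi.zero_apply]
        rw [Finset.mem_Icc] at hs ⊢
        rw [lt_abs] at hj
        omega
    simp only [Finset.sum_eq_zero this, zero_div, Pi.zero_apply]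
  · have hone : ∀ s ∈ Finset.Icc (-(k' : ℤ)) k', ∑ l, ∑ j ∈ Finset.Icc (-(m : ℤ)) m,
        ν l (j - s) ((h.toEquiv ^ (-s)) x) = 1 := fun s hs => by
      rw [Finset.mem_Icc] at hs
      rw [← hν1 ((h.toEquiv ^ (-s)) x) (Set.mem_biUnion (x := -s)
        ⟨by omega, by omega⟩ (Set.mem_image_of_mem _ hx))]
      refine Finset.sum_congr rfl fun l _ => ?_
      symm
      have hshift := Finset.sum_map (Finset.Icc (-(m : ℤ)) m) (addRightEmbedding (-s))
        fun i => ν l i ((h.toEquiv ^ (-s)) x)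
      rw [Finset.map_add_right_Icc] at hshift
      simp only [addRightEmbedding_apply, ← sub_eq_add_neg] at hshift
      rw [← hshift]
      refine Finset.sum_subset (Finset.Icc_subset_Icc (by omega) (by omega)) fun i _ hi => ?_
      rw [hν0 l i hi, Pi.zero_apply]
    simp only [← Finset.sum_div]
    rw [div_eq_one_iff_eq hN.ne', ← hcard]
    calc _ = ∑ s ∈ Finset.Icc (-(k' : ℤ)) k', ∑ l, ∑ j ∈ Finset.Icc (-(m : ℤ)) m,
          ν l (j - s) ((h.toEquiv ^ (-s)) x) := by
            rw [Finset.sum_comm (s := Finset.Icc (-(k' : ℤ)) k')]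
            exact Finset.sum_congr rfl fun l _ => Finset.sum_comm
      _ = _ := by rw [Finset.sum_congr rfl hone, Finset.sum_const, nsmul_one]
  · have hshift := abs_sum_Icc_sub_sum_Icc_add_le
      (f := fun s => ν l (j - s) ((h.toEquiv ^ (i - s)) x)) (fun s => hν01 _ _ _)
      (-(k' : ℤ)) k' i
    have hi' : |(i : ℝ)| ≤ k := by exact_mod_cast hi
    have hceil : 1 ≤ ε * ⌈1 / ε⌉₊ := by
      have := Nat.le_ceil (1 / ε)
      rwa [div_le_iff₀' hε] at this
    have hkε : (k : ℝ) < ε * (2 * k' + 1) := by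
      have hk0 : (0 : ℝ) ≤ k := k.cast_nonneg
      rw [hk']
      push_cast
      nlinarith
    have hleft : ∀ s, ν l (j - s) ((h.toEquiv ^ (-s)) ((h.toEquiv ^ i) x)) =
        ν l (j - s) ((h.toEquiv ^ (i - s)) x) := fun s => by
      rw [← Equiv.Perm.mul_apply, ← zpow_add, neg_add_eq_sub]
    have hright : ∀ s, ν l (j - i - s) ((h.toEquiv ^ (-s)) x) =
        ν l (j - (s + i)) ((h.toEquiv ^ (i - (s + i))) x) := fun s => by
      rw [show j - i - s = j - (s + i) by ring, show -s = i - (s + i) by ring]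
    simp only [hleft, hright]
    rw [← sub_div, abs_div, abs_of_pos hN, div_lt_iff₀ hN]
    exact (hshift.trans hi').trans_lt hkε
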